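/- Let n, m, q be natural numbers with n ≥ 2, m ≥ 1, q ≤ n − 2, and 2q + m ≤ C(n,2). Let V be an n-element vertex set and fix two distinct vertices v, u ∈ V. Let Ω be the set of all pairs (E, L) where E is an m-element edge set on V containing {v,u} and L is a q-element subset of V, and let S ⊆ Ω be the set of pairs for which the edge {v,u} is starved. Then, as real numbers, |S| / |Ω| = (C(n−2, q) · C(C(n,2) − 2q − 1, m−1)) / (C(n, q) · C(C(n,2) − 1, m−1)). -/

import Mathlib

open Finset

/-- The number of `m`-element subsets of `T` containing a given element of `T`. -/
theorem card_filter_mem_powersetCard {α : Type*} [DecidableEq α] (T : Finset α) {e : α}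
    (he : e ∈ T) {m : ℕ} (hm : 1 ≤ m) :
    ((T.powersetCard m).filter (fun s => e ∈ s)).card = (T.card - 1).choose (m - 1) := by
  rw [← card_erase_of_mem he, ← card_powersetCard]
  refine card_bij' (fun s _ => s.erase e) (fun s _ => insert e s) ?_ ?_ ?_ ?_
  · intro s hs
    simp only [mem_filter, mem_powersetCard] at hs ⊢
    exact ⟨erase_subset_erase e hs.1.1, by rw [card_erase_of_mem hs.2, hs.1.2]⟩
  · intro s hs
    simp only [mem_filter, mem_powersetCard] at hs ⊢
    have hes : e ∉ s := fun h => notMem_erase e T (hs.1 h)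
    refine ⟨⟨insert_subset he (hs.1.trans (erase_subset e T)), ?_⟩, mem_insert_self e s⟩
    rw [card_insert_of_notMem hes, hs.2]
    omega
  · intro s hs
    exact insert_erase (mem_filter.mp hs).2
  · intro s hs
    exact erase_insert fun h => notMem_erase e T ((mem_powersetCard.mp hs).1 h)

/-- The number of off-diagonal unordered pairs. -/
theorem card_filter_not_isDiag (V : Type*) [Fintype V] [DecidableEq V] :
    ((univ : Finset (Sym2 V)).filter (fun e => ¬ e.IsDiag)).card = (Fintype.card V).choose 2 := by
  rw [← Sym2.card_subtype_not_diag, Fintype.card_subtype]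

/-- The unordered pairs joining `v` or `u` to an element of `L`. -/
def pairsTo {V : Type*} [DecidableEq V] (v u : V) (L : Finset V) : Finset (Sym2 V) :=
  L.image (fun l => s(v, l)) ∪ L.image (fun l => s(u, l))

theorem card_pairsTo {V : Type*} [DecidableEq V] {v u : V} (hvu : v ≠ u) {L : Finset V}
    (hv : v ∉ L) : (pairsTo v u L).card = 2 * L.card := by
  have hinj : ∀ w : V, Function.Injective (fun l => s(w, l)) := fun w a b h =>
    Sym2.congr_right.mp h
  rw [pairsTo, card_union_of_disjoint, card_image_of_injective _ (hinj v),
    card_image_of_injective _ (hinj u), two_mul]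
  rw [disjoint_left]
  simp only [mem_image]
  rintro _ ⟨a, ha, rfl⟩ ⟨b, hb, h⟩
  rcases Sym2.eq_iff.mp h with ⟨h, -⟩ | ⟨-, h⟩
  · exact hvu h.symm
  · exact hv (h ▸ hb)

/-- With `Ω` the set of pairs `(E, L)` of an `m`-element edge set containing `{v,u}` and a
`q`-element labeled set, and `S ⊆ Ω` those pairs for which the edge `{v,u}` is starved,
`|S| / |Ω| = (C(n-2, q) * C(C(n,2) - 2q - 1, m-1)) / (C(n, q) * C(C(n,2) - 1, m-1))`. -/
theorem starved_edge_probability_counts {V : Type*} [Fintype V] [DecidableEq V]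
    (n m q : ℕ) (hn : 2 ≤ n) (hm : 1 ≤ m) (hq : q ≤ n - 2)
    (hmq : 2 * q + m ≤ n.choose 2)
    (hcard : Fintype.card V = n)
    (v u : V) (hvu : v ≠ u) :
    let Ω : Finset (Finset (Sym2 V) × Finset V) :=
      Finset.univ.filter (fun p =>
        p.1.card = m ∧ (∀ e ∈ p.1, ¬ e.IsDiag) ∧ s(v, u) ∈ p.1 ∧ p.2.card = q)
    let S : Finset (Finset (Sym2 V) × Finset V) :=
      Ω.filter (fun p =>
        v ∉ p.2 ∧ u ∉ p.2 ∧ ∀ ℓ ∈ p.2, s(v, ℓ) ∉ p.1 ∧ s(u, ℓ) ∉ p.1)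
    (S.card : ℝ) / (Ω.card : ℝ) =
      (((n - 2).choose q : ℝ) * ((n.choose 2 - 2 * q - 1).choose (m - 1) : ℝ)) /
        ((n.choose q : ℝ) * ((n.choose 2 - 1).choose (m - 1) : ℝ)) := by
  intro Ω S
  set D : Finset (Sym2 V) := univ.filter (fun e => ¬ e.IsDiag) with hD
  have hDcard : D.card = n.choose 2 := by rw [hD, card_filter_not_isDiag, hcard]
  have hΩ : Ω.card = n.choose q * (n.choose 2 - 1).choose (m - 1) := by
    have hprod : Ω = ((D.powersetCard m).filter (fun E => s(v, u) ∈ E)) ×ˢ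
        (univ : Finset V).powersetCard q := by
      ext ⟨E, L⟩
      simp only [Ω, hD, mem_filter, mem_univ, true_and, mem_product, mem_powersetCard,
        subset_iff, implies_true]
      tauto
    rw [hprod, card_product, card_filter_mem_powersetCard D (by simpa [hD] using hvu) hm,
      card_powersetCard, card_univ, hcard, hDcard, mul_comm]
  have hS : S.card = (n - 2).choose q * (n.choose 2 - 2 * q - 1).choose (m - 1) := by
    have hmaps : ∀ p ∈ S, p.2 ∈ (({v, u} : Finset V)ᶜ).powersetCard q := by
      rintro ⟨E, L⟩ hp
      simp only [S, Ω, mem_filter, mem_univ, true_and] at hp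
      obtain ⟨⟨-, -, -, hL⟩, hv, hu, -⟩ := hp
      refine mem_powersetCard.mpr ⟨fun x hx => ?_, hL⟩
      simp only [mem_compl, mem_insert, mem_singleton, not_or]
      exact ⟨fun h => hv (h ▸ hx), fun h => hu (h ▸ hx)⟩
    have hfiber : ∀ L ∈ (({v, u} : Finset V)ᶜ).powersetCard q,
        (S.filter (fun p => p.2 = L)).card = (n.choose 2 - 2 * q - 1).choose (m - 1) := by
      intro L hL
      obtain ⟨hLsub, hLcard⟩ := mem_powersetCard.mp hL
      have hv : v ∉ L := fun h => by simpa using hLsub h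
      have hu : u ∉ L := fun h => by simpa using hLsub h
      have hsub : pairsTo v u L ⊆ D := by
        intro e he
        simp only [pairsTo, mem_union, mem_image] at he
        rcases he with ⟨l, hl, rfl⟩ | ⟨l, hl, rfl⟩
        · simpa [hD] using fun h : v = l => hv (h ▸ hl)
        · simpa [hD] using fun h : u = l => hu (h ▸ hl)
      have hmem : s(v, u) ∈ D \ pairsTo v u L := by
        simp only [hD, pairsTo, mem_sdiff, mem_filter, mem_univ, true_and, mem_union, mem_image,
          Sym2.mk_isDiag_iff, not_or, not_exists, not_and]
        refine ⟨hvu, fun l hl h => ?_, fun l hl h => ?_⟩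
        · exact hu (Sym2.congr_right.mp h ▸ hl)
        · rw [Sym2.eq_swap (a := v)] at h
          exact hv (Sym2.congr_right.mp h ▸ hl)
      have hprod : S.filter (fun p => p.2 = L) =
          (((D \ pairsTo v u L).powersetCard m).filter (fun E => s(v, u) ∈ E)) ×ˢ {L} := by
        ext ⟨E, L'⟩
        simp only [S, Ω, mem_filter, mem_univ, true_and, mem_product, mem_singleton,
          mem_powersetCard]
        have hiff : E ⊆ D \ pairsTo v u L ↔
            (∀ e ∈ E, ¬ e.IsDiag) ∧ ∀ l ∈ L, s(v, l) ∉ E ∧ s(u, l) ∉ E := by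
          simp only [subset_iff, hD, pairsTo, mem_sdiff, mem_filter, mem_univ, true_and,
            mem_union, mem_image]
          constructor
          · exact fun h => ⟨fun e he => (h he).1, fun l hl =>
              ⟨fun he => (h he).2 (Or.inl ⟨l, hl, rfl⟩),
                fun he => (h he).2 (Or.inr ⟨l, hl, rfl⟩)⟩⟩
          · rintro ⟨h₁, h₂⟩ e he
            refine ⟨h₁ e he, ?_⟩
            rintro (⟨l, hl, rfl⟩ | ⟨l, hl, rfl⟩)
            · exact (h₂ l hl).1 he
            · exact (h₂ l hl).2 he
        rw [hiff]
        constructor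
        · rintro ⟨⟨⟨h₁, h₂, h₃, -⟩, -, -, h₄⟩, rfl⟩
          exact ⟨⟨⟨⟨h₂, h₄⟩, h₁⟩, h₃⟩, rfl⟩
        · rintro ⟨⟨⟨⟨h₂, h₄⟩, h₁⟩, h₃⟩, rfl⟩
          exact ⟨⟨⟨h₁, h₂, h₃, hLcard⟩, hv, hu, h₄⟩, rfl⟩
      rw [hprod, card_product, card_singleton, mul_one, card_filter_mem_powersetCard _ hmem hm,
        card_sdiff_of_subset hsub, card_pairsTo hvu hv, hDcard, hLcard]
    rw [card_eq_sum_card_fiberwise hmaps, sum_congr rfl hfiber, sum_const, card_powersetCard,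
      card_compl, card_pair hvu, hcard, smul_eq_mul]
  rw [hΩ, hS]
  push_cast
  rfl
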